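/- Let S be a stably locally compact formal topology. For any locally compact regular formal topology S′ and any perfect formal topology map r : S′ → S, there exists a unique perfect formal topology map r̃ : S′ → Patch(S) such that ε_P ∘ r̃ = r. Consequently, the patch construction exhibits the category of locally compact regular formal topologies and perfect maps as a coreflective subcategory of the category of stably locally compact formal topologies and perfect maps. -/

import Mathlib

noncomputable section
open Classical

universe u v

namespace FTP

/-! ### Basic covers -/

/-- `U ◁ V` : every element of `U` is covered by `V`. -/
def covS {S : Type*} (cov : S → Set S → Prop) (U V : Set S) : Prop :=
  ∀ a ∈ U, cov a V

/-- A basic cover: reflexivity and transitivity. -/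
def IsBasicCover {S : Type*} (cov : S → Set S → Prop) : Prop :=
  (∀ (a : S) (U : Set S), a ∈ U → cov a U) ∧
  (∀ (a : S) (U V : Set S), cov a U → covS cov U V → cov a V)

/-- the way-below relation `a ≪ b`. -/
def wb {S : Type*} (cov : S → Set S → Prop) (a b : S) : Prop :=
  ∀ U : Set S, cov b U → ∃ U₀ : Finset S, ↑U₀ ⊆ U ∧ cov a ↑U₀

/-- the way-below relation between subsets `U ≪ V`. -/
def wbS {S : Type*} (cov : S → Set S → Prop) (U V : Set S) : Prop :=
  ∀ W : Set S, covS cov V W → ∃ W₀ : Finset S, ↑W₀ ⊆ W ∧ covS cov U ↑W₀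

/-- A continuous basic cover, with the witnessing function `w`. -/
def IsContinuous {S : Type*} (cov : S → Set S → Prop) (w : S → Set S) : Prop :=
  (∀ a : S, ∀ b ∈ w a, wb cov b a) ∧ (∀ a : S, cov a (w a))

/-- splitting subsets. -/
def Splitting {S : Type*} (cov : S → Set S → Prop) (V : Set S) : Prop :=
  ∀ (a : S) (U : Set S), a ∈ V → cov a U → (V ∩ U).Nonempty

/-- located subsets. -/
def Located {S : Type*} (cov : S → Set S → Prop) (V : Set S) : Prop :=
  Splitting cov V ∧ ∀ a b : S, wb cov a b → a ∉ V ∨ b ∈ V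

/-- inverse image of a relation. -/
def rinv {α β : Type*} (r : α → β → Prop) (U : Set β) : Set α :=
  {x | ∃ a ∈ U, r x a}

/-- basic cover maps. -/
def IsBCM {α β : Type*} (cov : α → Set α → Prop) (cov' : β → Set β → Prop)
    (r : α → β → Prop) : Prop :=
  ∀ (a : β) (U : Set β), cov' a U → covS cov (rinv r {a}) (rinv r U)

/-- perfect maps. -/
def IsPerfect {α β : Type*} (cov : α → Set α → Prop) (cov' : β → Set β → Prop)
    (r : α → β → Prop) : Prop :=
  ∀ a b : β, wb cov' a b → wbS cov (rinv r {a}) (rinv r {b})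

/-- the terminal basic cover `1 = ({∗}, ∈)`. -/
def unitCov : Unit → Set Unit → Prop := fun x U => x ∈ U

/-! ### Formal topologies -/

/-- `U ↓ V` with respect to a preorder `le`. -/
def down {S : Type*} (le : S → S → Prop) (U V : Set S) : Set S :=
  {c | ∃ a ∈ U, ∃ b ∈ V, le c a ∧ le c b}

/-- A formal topology: a basic cover together with a compatible preorder. -/
def IsFormalTopology {S : Type*} (cov : S → Set S → Prop) (le : S → S → Prop) : Prop :=
  IsBasicCover cov ∧ Reflexive le ∧ Transitive le ∧
  (∀ a b : S, le a b → cov a {b}) ∧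
  (∀ (a : S) (U V : Set S), cov a U → cov a V → cov a (down le U V))

/-- formal topology maps. -/
def IsFTM {α β : Type*} (cov : α → Set α → Prop) (le : α → α → Prop)
    (cov' : β → Set β → Prop) (le' : β → β → Prop) (r : α → β → Prop) : Prop :=
  IsBCM cov cov' r ∧
  covS cov Set.univ (rinv r Set.univ) ∧
  ∀ a b : β, covS cov (down le (rinv r {a}) (rinv r {b})) (rinv r (down le' {a} {b}))

/-- the order on maps. -/
def MapLE {α β : Type*} (cov : α → Set α → Prop) (r s : α → β → Prop) : Prop :=
  ∀ a : β, covS cov (rinv r {a}) (rinv s {a})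

/-- equality of maps. -/
def MapEq {α β : Type*} (cov : α → Set α → Prop) (r s : α → β → Prop) : Prop :=
  MapLE cov r s ∧ MapLE cov s r

/-- composition of relational maps (`comp s r = s ∘ r`). -/
def comp {α β γ : Type*} (s : β → γ → Prop) (r : α → β → Prop) : α → γ → Prop :=
  fun x c => ∃ b, r x b ∧ s b c

/-- `b* = {c | c ↓ b ◁ ∅}`. -/
def star {S : Type*} (cov : S → Set S → Prop) (le : S → S → Prop) (b : S) : Set S :=
  {c | covS cov (down le {c} {b}) ∅}

/-- `b ⋘ a` iff `S ◁ b* ∪ {a}`. -/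
def wc {S : Type*} (cov : S → Set S → Prop) (le : S → S → Prop) (b a : S) : Prop :=
  covS cov Set.univ (star cov le b ∪ {a})

/-- regular formal topologies. -/
def Regular {S : Type*} (cov : S → Set S → Prop) (le : S → S → Prop) : Prop :=
  ∀ a : S, cov a {b | wc cov le b a}

/-- compactness: `S ≪ S`. -/
def Compact {S : Type*} (cov : S → Set S → Prop) : Prop :=
  wbS cov Set.univ Set.univ

/-- stability: `a ≪ a'` and `b ≪ b'` imply `a↓b ≪ a'↓b'`. -/
def Stable {S : Type*} (cov : S → Set S → Prop) (le : S → S → Prop) : Prop :=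
  ∀ a a' b b' : S, wb cov a a' → wb cov b b' →
    wbS cov (down le {a} {b}) (down le {a'} {b'})

/-- isomorphism of formal topologies. -/
def IsIso {α β : Type*} (cov : α → Set α → Prop) (le : α → α → Prop)
    (cov' : β → Set β → Prop) (le' : β → β → Prop) : Prop :=
  ∃ (r : α → β → Prop) (s : β → α → Prop),
    IsFTM cov le cov' le' r ∧ IsFTM cov' le' cov le s ∧
    MapEq cov (comp s r) (fun a b => a = b) ∧
    MapEq cov' (comp r s) (fun a b => a = b)

/-! ### Geometric theories and the covers they present -/

/-- the preorder `A ≤ B ↔ B ⊆ A` on finite sets of generators. -/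
def supord {P : Type*} : Finset P → Finset P → Prop := fun A B => B ⊆ A

/-- The cover on `Finset P` inductively generated by a geometric theory `T`
(an axiom `T A 𝒞` means `⋀A ⊢ ⋁_{B ∈ 𝒞} ⋀B`). -/
inductive GCov {P : Type*} (T : Finset P → Set (Finset P) → Prop) :
    Finset P → Set (Finset P) → Prop where
  | refl {A : Finset P} {𝒰 : Set (Finset P)} : A ∈ 𝒰 → GCov T A 𝒰
  | le {A B : Finset P} {𝒰 : Set (Finset P)} : B ⊆ A → GCov T B 𝒰 → GCov T A 𝒰
  | ax {A : Finset P} {𝒞 𝒰 : Set (Finset P)} (C : Finset P) :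
      T A 𝒞 → (∀ B ∈ 𝒞, GCov T (C ∪ B) 𝒰) → GCov T (C ∪ A) 𝒰

theorem GCov_trans {P : Type*} {T : Finset P → Set (Finset P) → Prop}
    {A : Finset P} {𝒰 𝒱 : Set (Finset P)}
    (h : GCov T A 𝒰) (h' : ∀ B ∈ 𝒰, GCov T B 𝒱) : GCov T A 𝒱 := by
  induction h with
  | refl hA => exact h' _ hA
  | le hBA _ ih => exact GCov.le hBA (ih h')
  | ax C hT _ ih => exact GCov.ax C hT (fun B hB => ih B hB h')

theorem GCov_isBasicCover {P : Type*} (T : Finset P → Set (Finset P) → Prop) :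
    IsBasicCover (GCov T) :=
  ⟨fun _ _ h => GCov.refl h, fun _ _ _ h h' => GCov_trans h h'⟩

/-! ### The patch, Lawson and lower powerlocale theories -/

/-- generators of the patch/Lawson theories : `r a` and `l A`. -/
inductive PatchGen (S : Type u) : Type u where
  | r : S → PatchGen S
  | l : Finset S → PatchGen S

/-- The geometric theory `T_P` presenting the patch of a stably locally compact
formal topology. -/
inductive PatchThy {S : Type*} (cov : S → Set S → Prop) (le : S → S → Prop) :
    Finset (PatchGen S) → Set (Finset (PatchGen S)) → Prop where
  | R1 : PatchThy cov le ∅ {B | ∃ a : S, B = {PatchGen.r a}}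
  | R2 (a b : S) :
      PatchThy cov le {PatchGen.r a, PatchGen.r b}
        {B | ∃ c ∈ down le {a} {b}, B = {PatchGen.r c}}
  | R3 (a : S) (A : Finset S) :
      cov a ↑A → PatchThy cov le {PatchGen.r a} {B | ∃ b ∈ A, B = {PatchGen.r b}}
  | R4 (a : S) :
      PatchThy cov le {PatchGen.r a} {B | ∃ b : S, wb cov b a ∧ B = {PatchGen.r b}}
  | L1 : PatchThy cov le ∅ {({PatchGen.l ∅} : Finset (PatchGen S))}
  | L2 (A B : Finset S) :
      covS cov ↑A ↑B →
      PatchThy cov le {PatchGen.l B} {({PatchGen.l A} : Finset (PatchGen S))}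
  | L3 (A B : Finset S) :
      PatchThy cov le {PatchGen.l A, PatchGen.l B}
        {D | ∃ C : Finset S, wbS cov ↑A ↑C ∧ wbS cov ↑B ↑C ∧ D = {PatchGen.l C}}
  | Loc (a b : S) :
      wb cov a b →
      PatchThy cov le ∅
        {({PatchGen.l {a}} : Finset (PatchGen S)), ({PatchGen.r b} : Finset (PatchGen S))}
  | D (a : S) :
      PatchThy cov le {PatchGen.l {a}, PatchGen.r a} (∅ : Set (Finset (PatchGen S)))

/-- the cover of `Patch(S)`. -/
def patchCov {S : Type*} (cov : S → Set S → Prop) (le : S → S → Prop) :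
    Finset (PatchGen S) → Set (Finset (PatchGen S)) → Prop :=
  GCov (PatchThy cov le)

/-- the counit `ε_P : Patch(S) → S`. -/
def epsP {S : Type*} (cov : S → Set S → Prop) (le : S → S → Prop) :
    Finset (PatchGen S) → S → Prop :=
  fun 𝔄 a => patchCov cov le 𝔄 {({PatchGen.r a} : Finset (PatchGen S))}

/-- The geometric theory `T_L` presenting the Lawson topology of a continuous
basic cover (the axioms of `T_P` without (R1), (R2)). -/
inductive LawsonThy {S : Type*} (cov : S → Set S → Prop) :
    Finset (PatchGen S) → Set (Finset (PatchGen S)) → Prop where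
  | R3 (a : S) (A : Finset S) :
      cov a ↑A → LawsonThy cov {PatchGen.r a} {B | ∃ b ∈ A, B = {PatchGen.r b}}
  | R4 (a : S) :
      LawsonThy cov {PatchGen.r a} {B | ∃ b : S, wb cov b a ∧ B = {PatchGen.r b}}
  | L1 : LawsonThy cov ∅ {({PatchGen.l ∅} : Finset (PatchGen S))}
  | L2 (A B : Finset S) :
      covS cov ↑A ↑B →
      LawsonThy cov {PatchGen.l B} {({PatchGen.l A} : Finset (PatchGen S))}
  | L3 (A B : Finset S) :
      LawsonThy cov {PatchGen.l A, PatchGen.l B}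
        {D | ∃ C : Finset S, wbS cov ↑A ↑C ∧ wbS cov ↑B ↑C ∧ D = {PatchGen.l C}}
  | Loc (a b : S) :
      wb cov a b →
      LawsonThy cov ∅
        {({PatchGen.l {a}} : Finset (PatchGen S)), ({PatchGen.r b} : Finset (PatchGen S))}
  | D (a : S) :
      LawsonThy cov {PatchGen.l {a}, PatchGen.r a} (∅ : Set (Finset (PatchGen S)))

/-- the cover of the Lawson topology `L(S)`. -/
def lawsonCov {S : Type*} (cov : S → Set S → Prop) :
    Finset (PatchGen S) → Set (Finset (PatchGen S)) → Prop :=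
  GCov (LawsonThy cov)

/-- the counit `ε_L : L(S) → S`. -/
def epsL {S : Type*} (cov : S → Set S → Prop) : Finset (PatchGen S) → S → Prop :=
  fun 𝔄 a => lawsonCov cov 𝔄 {({PatchGen.r a} : Finset (PatchGen S))}

/-- The theory presenting the lower powerlocale of a continuous basic cover:
generators `a ∈ S`, axioms (R3) and (R4). -/
inductive LowerThy {S : Type*} (cov : S → Set S → Prop) :
    Finset S → Set (Finset S) → Prop where
  | R3 (a : S) (A : Finset S) :
      cov a ↑A → LowerThy cov {a} {B | ∃ b ∈ A, B = ({b} : Finset S)}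
  | R4 (a : S) :
      LowerThy cov {a} {B | ∃ b : S, wb cov b a ∧ B = ({b} : Finset S)}

/-- the cover of the lower powerlocale `Lower(S)`. -/
def lowerCov {S : Type*} (cov : S → Set S → Prop) :
    Finset S → Set (Finset S) → Prop :=
  GCov (LowerThy cov)

/-- the counit `σ_L : Lower(S) → S`. -/
def sigmaL {S : Type*} (cov : S → Set S → Prop) : Finset S → S → Prop :=
  fun A a => lowerCov cov A ({({a} : Finset S)} : Set (Finset S))

/-! ### de Groot duals -/

/-- `↟A = {B ∈ Fin S | A ≪ B}`. -/
def upF {S : Type*} (cov : S → Set S → Prop) (A : Finset S) : Set (Finset S) :=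
  {B | wbS cov ↑A ↑B}

/-- the finite join `⋁^F {↟A | A ∈ 𝒜}` of Scott open filters. -/
def finJoin {S : Type*} (cov : S → Set S → Prop) (le : S → S → Prop)
    (𝒜 : Finset (Finset S)) : Set (Finset S) :=
  if 𝒜 = ∅ then {B | covS cov Set.univ ↑B}
  else {B | ∃ g : Finset S → Finset S,
    (∀ A ∈ 𝒜, wbS cov ↑A ↑(g A)) ∧
    wbS cov {c | ∀ A ∈ 𝒜, ∃ b ∈ g A, le c b} ↑B}

/-- The cover `◁^D` of the de Groot dual `S^D`, inductively generated on
`(Fin S, ⊇)` by the axioms (D3) `A ◁ ↟A` and (D4). -/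
inductive DCov {S : Type*} (cov : S → Set S → Prop) (le : S → S → Prop) :
    Finset S → Set (Finset S) → Prop where
  | refl {A : Finset S} {𝒰 : Set (Finset S)} : A ∈ 𝒰 → DCov cov le A 𝒰
  | le {A B : Finset S} {𝒰 : Set (Finset S)} :
      B ⊆ A → DCov cov le B 𝒰 → DCov cov le A 𝒰
  | d3 {A A' : Finset S} {𝒰 : Set (Finset S)} :
      A ⊆ A' →
      (∀ C : Finset S, A' ⊆ C → (∃ B : Finset S, wbS cov ↑A ↑B ∧ B ⊆ C) →
        DCov cov le C 𝒰) →
      DCov cov le A' 𝒰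
  | d4 {A A' : Finset S} {𝒜 : Finset (Finset S)} {𝒰 : Set (Finset S)} :
      A ⊆ A' → upF cov A ⊆ finJoin cov le 𝒜 →
      (∀ C : Finset S, A' ⊆ C → (∃ B ∈ 𝒜, B ⊆ C) → DCov cov le C 𝒰) →
      DCov cov le A' 𝒰

/-- the cover of the Scott topology `Σ(S)` on `(Fin S, ⊇)`. -/
def scottCov {S : Type*} (cov : S → Set S → Prop) :
    Finset S → Set (Finset S) → Prop :=
  fun A 𝒰 => upF cov A ⊆ ⋃ B ∈ 𝒰, upF cov B

/-- a filter (with respect to `◁`) of basic opens, given by a set of finite subsets. -/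
def IsCovFilter {S : Type*} (cov : S → Set S → Prop) (le : S → S → Prop)
    (𝒱 : Set (Finset S)) : Prop :=
  𝒱.Nonempty ∧
  (∀ A ∈ 𝒱, ∀ B : Finset S, covS cov ↑A ↑B → B ∈ 𝒱) ∧
  (∀ A ∈ 𝒱, ∀ B ∈ 𝒱, ∃ C ∈ 𝒱, covS cov ↑C (down le ↑A ↑B))

/-- The geometric theory `T^d` presenting the de Groot dual `S^d`:
generators `l A` (identified with `A : Finset S`), axioms (L1)–(L3) and (D4). -/
inductive DGThy {S : Type*} (cov : S → Set S → Prop) (le : S → S → Prop) :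
    Finset (Finset S) → Set (Finset (Finset S)) → Prop where
  | L1 : DGThy cov le ∅ {({(∅ : Finset S)} : Finset (Finset S))}
  | L2 (A B : Finset S) :
      covS cov ↑A ↑B → DGThy cov le {B} {({A} : Finset (Finset S))}
  | L3 (A B : Finset S) :
      DGThy cov le {A, B}
        {D | ∃ C : Finset S, wbS cov ↑A ↑C ∧ wbS cov ↑B ↑C ∧ D = ({C} : Finset (Finset S))}
  | D4 (A : Finset S) (𝒜 : Finset (Finset S)) :
      upF cov A ⊆ finJoin cov le 𝒜 →
      DGThy cov le {A} {D | ∃ B ∈ 𝒜, D = ({B} : Finset (Finset S))}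

/-! ### Spectral formal topologies -/

/-- spectral formal topologies: a compatible meet-semilattice structure on the
base, with every basic element way-below itself. -/
def IsSpectral {S : Type*} (cov : S → Set S → Prop) (le : S → S → Prop)
    (one : S) (meet : S → S → S) : Prop :=
  (∀ a : S, cov a {one}) ∧
  (∀ a b : S, cov (meet a b) (down le {a} {b})) ∧
  (∀ a b : S, ∀ c ∈ down le {a} {b}, cov c {meet a b}) ∧
  (∀ a : S, wb cov a a)

/-! ### Subtopologies -/

/-- the property of being a formal-topology cover compatible with `le`. -/
def IsFTCover {S : Type*} (cov : S → Set S → Prop) (le : S → S → Prop) : Prop :=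
  IsBasicCover cov ∧ (∀ a b : S, le a b → cov a {b}) ∧
  (∀ (a : S) (U V : Set S), cov a U → cov a V → cov a (down le U V))

/-- The meet (in `SubTop(S)`) of a family of subtopology covers: the least
formal-topology cover containing all of them. -/
def covMeet {S : Type*} {ι : Sort*} (le : S → S → Prop)
    (F : ι → (S → Set S → Prop)) : S → Set S → Prop :=
  fun a U => ∀ c : S → Set S → Prop,
    IsFTCover c le → (∀ i : ι, ∀ (a' : S) (U' : Set S), F i a' U' → c a' U') → c a U

/-- the closed subtopology `C_a` determined by `{a}`. -/
def closedCov {S : Type*} (cov : S → Set S → Prop) (a : S) : S → Set S → Prop :=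
  fun c V => cov c ({a} ∪ V)

/-- the open subtopology `S_B` determined by a finite `B`. -/
def openCov {S : Type*} (cov : S → Set S → Prop) (le : S → S → Prop)
    (B : Finset S) : S → Set S → Prop :=
  fun c V => covS cov (down le {c} ↑B) V

/-- `K_A = ⋀_{A ≪ B} S_B`. -/
def KCov {S : Type*} (cov : S → Set S → Prop) (le : S → S → Prop) (A : Finset S) :
    S → Set S → Prop :=
  covMeet le (fun B : {B : Finset S // wbS cov ↑A ↑B} => openCov cov le B.1)

/-- `C_a ∨ K_A` (the join of subtopologies is the intersection of covers). -/
def CKCov {S : Type*} (cov : S → Set S → Prop) (le : S → S → Prop)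
    (a : S) (A : Finset S) : S → Set S → Prop :=
  fun c V => closedCov cov a c V ∧ KCov cov le A c V

/-- perfect subtopologies. -/
def IsPerfectSub {S : Type*} (cov : S → Set S → Prop) (le : S → S → Prop)
    (cov' : S → Set S → Prop) : Prop :=
  IsFTCover cov' le ∧ (∀ (a : S) (U : Set S), cov a U → cov' a U) ∧
  (∀ a b : S, wb cov a b → wb cov' a b)

/-- the order of `PSub(S)`: `(a,A) ≤ (b,B)` iff `C_b ∨ K_B ⊑ C_a ∨ K_A`. -/
def PSubLe {S : Type*} (cov : S → Set S → Prop) (le : S → S → Prop) :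
    S × Finset S → S × Finset S → Prop :=
  fun p q => ∀ (c : S) (V : Set S), CKCov cov le p.1 p.2 c V → CKCov cov le q.1 q.2 c V

/-- the cover of `PSub(S)`: `(a,A) ◁ U` iff `⋀{C_b ∨ K_B | (b,B) ∈ U} ⊑ C_a ∨ K_A`. -/
def covPSub {S : Type*} (cov : S → Set S → Prop) (le : S → S → Prop) :
    S × Finset S → Set (S × Finset S) → Prop :=
  fun p U => ∀ (c : S) (V : Set S), CKCov cov le p.1 p.2 c V →
    covMeet le (fun q : U => CKCov cov le q.1.1 q.1.2) c V

/-- the map `r : PSub(S) → Patch(S)` on generators. -/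
def rGenPS {S : Type*} (cov : S → Set S → Prop) (le : S → S → Prop)
    (p : S × Finset S) : PatchGen S → Prop
  | PatchGen.r b => covPSub cov le p {((b, (∅ : Finset S)) : S × Finset S)}
  | PatchGen.l B => covPSub cov le p {q : S × Finset S | q.2 = B}

/-- the map `r : PSub(S) → Patch(S)`, extended along the presentation. -/
def rPS {S : Type*} (cov : S → Set S → Prop) (le : S → S → Prop) :
    S × Finset S → Finset (PatchGen S) → Prop :=
  fun p 𝔅 => ∀ g ∈ 𝔅, covPSub cov le p (rinv (fun q g' => rGenPS cov le q g') {g})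

/-- the map `s : Patch(S) → PSub(S)`. -/
def sPS {S : Type*} (cov : S → Set S → Prop) (le : S → S → Prop) :
    Finset (PatchGen S) → (S × Finset S) → Prop :=
  fun 𝔄 p => patchCov cov le 𝔄
    ({({PatchGen.r p.1, PatchGen.l p.2} : Finset (PatchGen S))} : Set (Finset (PatchGen S)))

/-! ### Saturated subsets, dcpos and preframes -/

/-- the saturated subsets of a basic cover. -/
abbrev SatSet {α : Type*} (cov : α → Set α → Prop) : Type _ :=
  {U : Set α // ∀ a, cov a U → a ∈ U}

/-- the join of a family of saturated subsets. -/
def satSup {α : Type*} {cov : α → Set α → Prop} (hbc : IsBasicCover cov)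
    (D : Set (SatSet cov)) : SatSet cov :=
  ⟨{a | cov a (⋃ U ∈ D, (U : Set α))}, fun a h => hbc.2 a _ _ h (fun _ hb => hb)⟩

/-- inductively generated basic covers: `BGen Ax` is the cover generated by the
axiom-set with axioms `a ◁ C` for `C ∈ Ax a`. -/
inductive BGen {S : Type*} (Ax : S → Set (Set S)) : S → Set S → Prop where
  | refl {a : S} {U : Set S} : a ∈ U → BGen Ax a U
  | infty {a : S} {U : Set S} (C : Set S) :
      C ∈ Ax a → (∀ b ∈ C, BGen Ax b U) → BGen Ax a U

theorem BGen_trans {S : Type*} {Ax : S → Set (Set S)} {a : S} {U V : Set S}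
    (h : BGen Ax a U) (h' : ∀ b ∈ U, BGen Ax b V) : BGen Ax a V := by
  induction h with
  | refl ha => exact h' _ ha
  | infty C hC _ ih => exact BGen.infty C hC (fun b hb => ih b hb h')

theorem BGen_isBasicCover {S : Type*} (Ax : S → Set (Set S)) :
    IsBasicCover (BGen Ax) :=
  ⟨fun _ _ h => BGen.refl h, fun _ _ _ h h' => BGen_trans h h'⟩

/-- the lower powerlocale theory of an inductively generated basic cover. -/
inductive LowerThyAx {S : Type*} (Ax : S → Set (Set S)) :
    Finset S → Set (Finset S) → Prop where
  | mk (a : S) (C : Set S) :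
      C ∈ Ax a → LowerThyAx Ax {a} {B | ∃ b ∈ C, B = ({b} : Finset S)}

/-- the counit `σ_L : Lower(S) → S` for an inductively generated basic cover. -/
def sigmaLAx {S : Type*} (Ax : S → Set (Set S)) : Finset S → S → Prop :=
  fun A a => GCov (LowerThyAx Ax) A ({({a} : Finset S)} : Set (Finset S))

/-- the top saturated subset of a presented topology. -/
def satTop {P : Type*} (T : Finset P → Set (Finset P) → Prop) : SatSet (GCov T) :=
  ⟨Set.univ, fun _ _ => Set.mem_univ _⟩

/-- binary meets of saturated subsets of a presented topology. -/
def satInfL {P : Type*} (T : Finset P → Set (Finset P) → Prop)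
    (U V : SatSet (GCov T)) : SatSet (GCov T) :=
  ⟨{A | GCov T A (down supord (U : Set (Finset P)) (V : Set (Finset P)))},
   fun _ h => GCov_trans h (fun _ hB => hB)⟩

/-- the suplattice homomorphism `σ_L* : Sat(S) → Sat(Lower(S))`. -/
def sigmaStar {S : Type*} (Ax : S → Set (Set S)) (U : SatSet (BGen Ax)) :
    SatSet (GCov (LowerThyAx Ax)) :=
  ⟨{A : Finset S | GCov (LowerThyAx Ax) A (rinv (sigmaLAx Ax) (U : Set S))},
   fun _ h => GCov_trans h (fun _ hB => hB)⟩

/-- a preframe structure on a partial order: finite meets and directed joins,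
with finite meets distributing over directed joins. -/
structure PreframeStr (X : Type*) [PartialOrder X] where
  top : X
  inf : X → X → X
  dSup : Set X → X
  le_top : ∀ x, x ≤ top
  inf_le_left : ∀ x y, inf x y ≤ x
  inf_le_right : ∀ x y, inf x y ≤ y
  le_inf : ∀ x y z, x ≤ y → x ≤ z → x ≤ inf y z
  le_dSup : ∀ d : Set X, d.Nonempty → DirectedOn (· ≤ ·) d → ∀ x ∈ d, x ≤ dSup d
  dSup_le : ∀ d : Set X, d.Nonempty → DirectedOn (· ≤ ·) d →
    ∀ z, (∀ x ∈ d, x ≤ z) → dSup d ≤ z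
  distrib : ∀ (x : X) (d : Set X), d.Nonempty → DirectedOn (· ≤ ·) d →
    inf x (dSup d) = dSup ((fun y => inf x y) '' d)

/-- dcpo homomorphisms out of `Sat(S)`. -/
def IsDcpoHom {α : Type*} {cov : α → Set α → Prop} (hbc : IsBasicCover cov)
    {X : Type*} [PartialOrder X] (PF : PreframeStr X) (f : SatSet cov → X) : Prop :=
  Monotone f ∧
  ∀ D : Set (SatSet cov), D.Nonempty → DirectedOn (· ≤ ·) D →
    f (satSup hbc D) = PF.dSup (f '' D)

/-- preframe homomorphisms out of the frame of a presented topology. -/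
def IsPreframeHomL {P : Type*} (T : Finset P → Set (Finset P) → Prop)
    {X : Type*} [PartialOrder X] (PF : PreframeStr X)
    (F : SatSet (GCov T) → X) : Prop :=
  Monotone F ∧ F (satTop T) = PF.top ∧
  (∀ U V, F (satInfL T U V) = PF.inf (F U) (F V)) ∧
  ∀ D : Set (SatSet (GCov T)), D.Nonempty → DirectedOn (· ≤ ·) D →
    F (satSup (GCov_isBasicCover T) D) = PF.dSup (F '' D)

/-! ### Located subsets: auxiliary notions -/

/-- the lower part `L_V` associated to a located subset `V`. -/
def LV {S : Type*} (cov : S → Set S → Prop) (V : Set S) : Set S :=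
  {a | ∃ A : Finset S, wbS cov {a} ↑A ∧ (↑A ∩ V : Set S) = ∅}

/-- cuts of a continuous basic cover. -/
def IsCut {S : Type*} (cov : S → Set S → Prop) (L U : Set S) : Prop :=
  (∀ (a : S) (A : Finset S), cov a ↑A → a ∈ U → ((↑A : Set S) ∩ U).Nonempty) ∧
  (∀ a ∈ U, ∃ b : S, wb cov b a ∧ b ∈ U) ∧
  (∀ (a : S) (A : Finset S), cov a ↑A → (↑A : Set S) ⊆ L → a ∈ L) ∧
  (∀ a ∈ L, ∃ A : Finset S, wbS cov {a} ↑A ∧ (↑A : Set S) ⊆ L) ∧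
  (∀ a b : S, wb cov a b → a ∈ L ∨ b ∈ U) ∧
  L ∩ U = ∅

end FTP

namespace FTP

/-! ### Covers in a formal topology -/

section Covers

variable {S : Type*} {cov : S → Set S → Prop} {le : S → S → Prop}

theorem IsBasicCover.mono (h : IsBasicCover cov) {a : S} {U V : Set S}
    (ha : cov a U) (hUV : U ⊆ V) : cov a V :=
  h.2 a U V ha fun b hb => h.1 b V (hUV hb)

theorem wbS_covS (h : IsBasicCover cov) {U V : Set S} (hUV : wbS cov U V) : covS cov U V := by
  obtain ⟨W, hW, hU⟩ := hUV V fun a ha => h.1 a V ha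
  exact fun a ha => h.mono (hU a ha) hW

theorem covS_wbS (h : IsBasicCover cov) {U V W : Set S} (hUV : covS cov U V)
    (hVW : wbS cov V W) : wbS cov U W := fun X hX => by
  obtain ⟨X₀, hX₀, hV⟩ := hVW X hX
  exact ⟨X₀, hX₀, fun a ha => h.2 a V _ (hUV a ha) hV⟩

theorem wbS_covS_trans (h : IsBasicCover cov) {U V W : Set S} (hUV : wbS cov U V)
    (hVW : covS cov V W) : wbS cov U W := fun X hX =>
  hUV X fun a ha => h.2 a W X (hVW a ha) hX

/-- A finite union of sets way below `V` is way below `V`. -/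
theorem wbS_of_forall_finset (h : IsBasicCover cov) {ι : Type*} (I : Finset ι)
    (F : ι → Set S) {U V : Set S} (hU : covS cov U {x | ∃ i ∈ I, x ∈ F i})
    (hF : ∀ i ∈ I, wbS cov (F i) V) : wbS cov U V := by
  intro W hW
  choose! X hX hFX using fun i hi => hF i hi W hW
  refine ⟨I.biUnion X, ?_, fun a ha => h.2 a _ _ (hU a ha) ?_⟩
  · intro x hx
    obtain ⟨i, hi, hxi⟩ := Finset.mem_biUnion.1 (Finset.mem_coe.1 hx)
    exact hX i hi hxi
  · rintro x ⟨i, hi, hx⟩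
    exact h.mono (hFX i hi x hx) (Finset.coe_subset.2 (Finset.subset_biUnion_of_mem X hi))

theorem wb_wbS {a b : S} {V : Set S} (hab : wb cov a b) (hb : b ∈ V) :
    wbS cov {a} V := by
  intro W hW
  obtain ⟨W₀, hW₀, ha⟩ := hab W (hW b hb)
  refine ⟨W₀, hW₀, ?_⟩
  rintro x rfl
  exact ha

theorem wbS_of_forall_wb (h : IsBasicCover cov) {A : Finset S} {V : Set S}
    (hA : ∀ a ∈ A, ∃ b ∈ V, wb cov a b) : wbS cov ↑A V := by
  refine wbS_of_forall_finset h A (fun a => {a}) (fun a ha => h.1 _ _ ⟨a, ha, rfl⟩) ?_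
  intro a ha
  obtain ⟨b, hb, hab⟩ := hA a ha
  exact wb_wbS hab hb

theorem IsContinuous.cov_wb (h : IsBasicCover cov) {w : S → Set S} (hw : IsContinuous cov w)
    (a : S) : cov a {b | wb cov b a} :=
  h.mono (hw.2 a) fun b hb => hw.1 a b hb

theorem IsContinuous.exists_finset_wb (h : IsBasicCover cov) {w : S → Set S}
    (hw : IsContinuous cov w) {U V : Set S} (hUV : wbS cov U V) :
    ∃ D : Finset S, covS cov U ↑D ∧ ∀ d ∈ D, ∃ c ∈ V, wb cov d c := by
  obtain ⟨D, hD, hU⟩ := hUV {d | ∃ c ∈ V, wb cov d c} fun c hc =>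
    h.mono (hw.cov_wb h c) fun d hd => ⟨c, hc, hd⟩
  exact ⟨D, hU, fun d hd => hD hd⟩

theorem IsContinuous.interpolate (h : IsBasicCover cov) {w : S → Set S}
    (hw : IsContinuous cov w) {U V : Set S} (hUV : wbS cov U V) :
    ∃ D : Finset S, wbS cov U ↑D ∧ wbS cov ↑D V := by
  have hV : covS cov V {d | ∃ c ∈ V, wb cov d c} := fun c hc =>
    h.mono (hw.cov_wb h c) fun d hd => ⟨c, hc, hd⟩
  obtain ⟨E, hE, hEV⟩ := hw.exists_finset_wb h (wbS_covS_trans h hUV hV)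
  choose! f hf hEf using hEV
  refine ⟨E.image f, ?_, ?_⟩
  · exact covS_wbS h hE
      (wbS_of_forall_wb h fun e he => ⟨f e, by simpa using ⟨e, he, rfl⟩, hEf e he⟩)
  · refine wbS_of_forall_wb h fun d hd => ?_
    obtain ⟨e, he, rfl⟩ := Finset.mem_image.1 hd
    exact hf e he

theorem IsFormalTopology.cov_of_le (h : IsFormalTopology cov le) {x y : S} {U : Set S}
    (hxy : le x y) (hy : cov y U) : cov x U := by
  refine h.1.2 x {y} U (h.2.2.2.1 x y hxy) ?_
  rintro z rfl
  exact hy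

theorem IsFormalTopology.cov_local (h : IsFormalTopology cov le) {x : S} {U V : Set S}
    (hx : cov x U) (hV : ∀ y, le y x → ∀ u ∈ U, le y u → cov y V) : cov x V := by
  refine h.1.2 x _ V (h.2.2.2.2 x {x} U (h.1.1 _ _ rfl) hx) ?_
  rintro y ⟨_, rfl, u, hu, hyx, hyu⟩
  exact hV y hyx u hu hyu

/-- The pseudocomplement of (the open presented by) `U`. -/
def pcompl (cov : S → Set S → Prop) (le : S → S → Prop) (U : Set S) : Set S :=
  {x | ∀ y, le y x → cov y U → cov y ∅}

theorem IsFormalTopology.pcompl_of_le (h : IsFormalTopology cov le) {U : Set S} {x y : S}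
    (hxy : le x y) (hy : y ∈ pcompl cov le U) : x ∈ pcompl cov le U :=
  fun z hz => hy z (h.2.2.1 hz hxy)

theorem IsFormalTopology.pcompl_anti (h : IsFormalTopology cov le) {U V : Set S}
    (hUV : covS cov U V) : pcompl cov le V ⊆ pcompl cov le U :=
  fun _ hx y hy hyU => hx y hy (h.1.2 y U V hyU hUV)

theorem IsFormalTopology.pcompl_iUnion (h : IsFormalTopology cov le) {ι : Type*} {I : Set ι}
    {F : ι → Set S} {x : S} (hx : ∀ i ∈ I, x ∈ pcompl cov le (F i)) :
    x ∈ pcompl cov le {y | ∃ i ∈ I, y ∈ F i} := by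
  intro y hy hyU
  refine h.cov_local hyU ?_
  rintro z hzy u ⟨i, hi, hu⟩ hzu
  exact hx i hi z (h.2.2.1 hzy hy) (h.cov_of_le hzu (h.1.1 _ _ hu))

theorem IsFormalTopology.star_subset_pcompl (h : IsFormalTopology cov le) (b : S) :
    star cov le b ⊆ pcompl cov le {b} := by
  intro x hx y hyx hyb
  refine h.cov_local hyb ?_
  rintro z hzy _ rfl hzb
  exact hx z ⟨x, rfl, _, rfl, h.2.2.1 hzy hyx, hzb⟩

/-- Finite distributivity of `∪` over intersections of down-closed sets. -/
theorem IsFormalTopology.cov_finset_inter_union (h : IsFormalTopology cov le) {ι : Type*}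
    (I : Finset ι) {P : ι → Set S} {V : Set S}
    (hP : ∀ i ∈ I, ∀ x y, le x y → y ∈ P i → x ∈ P i)
    (hcov : ∀ i ∈ I, ∀ x, cov x (P i ∪ V)) (x : S) :
    cov x ({y | ∀ i ∈ I, y ∈ P i} ∪ V) := by
  induction I using Finset.induction_on with
  | empty => exact h.1.1 _ _ (Or.inl (by simp))
  | insert i I _ ih =>
    have ih := ih (fun j hj => hP j (Finset.mem_insert_of_mem hj))
      fun j hj => hcov j (Finset.mem_insert_of_mem hj)
    refine h.cov_local ih ?_
    rintro y - u (hu | hu) hyu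
    · refine h.cov_local (hcov i (Finset.mem_insert_self i I) y) ?_
      rintro z hzy v (hv | hv) hzv
      · refine h.1.1 _ _ (Or.inl fun j hj => ?_)
        rcases Finset.mem_insert.1 hj with rfl | hj'
        · exact hP j hj z v hzv hv
        · exact hP j hj z u (h.2.2.1 hzy hyu) (hu j hj')
      · exact h.cov_of_le hzv (h.1.1 _ _ (Or.inr hv))
    · exact h.cov_of_le hyu (h.1.1 _ _ (Or.inr hu))

/-- If finitely many opens are all well inside `V`, so is their union. -/
theorem IsFormalTopology.cov_pcompl_iUnion (h : IsFormalTopology cov le) {ι : Type*}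
    (I : Finset ι) {F : ι → Set S} {V : Set S}
    (hcov : ∀ i ∈ I, ∀ x, cov x (pcompl cov le (F i) ∪ V)) (x : S) :
    cov x (pcompl cov le {y | ∃ i ∈ I, y ∈ F i} ∪ V) := by
  refine h.1.mono (h.cov_finset_inter_union I
    (fun i _ x y hxy hy => h.pcompl_of_le hxy hy) hcov x) (Set.union_subset_union_left _ ?_)
  exact fun y hy => h.pcompl_iUnion (I := {i | i ∈ I}) hy

/-- In a regular formal topology, `U ≪ V` implies that `U` is well inside `V`. -/
theorem Regular.cov_pcompl_of_wbS (h : IsFormalTopology cov le) (hreg : Regular cov le)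
    {U V : Set S} (hUV : wbS cov U V) (x : S) : cov x (pcompl cov le U ∪ V) := by
  obtain ⟨B, hB, hU⟩ := hUV {b | ∃ v ∈ V, wc cov le b v} fun v hv =>
    h.1.mono (hreg v) fun b hb => ⟨v, hv, hb⟩
  have key := h.cov_pcompl_iUnion B (F := fun b => {b}) (V := V) (fun b hb x => by
    obtain ⟨v, hv, hbv⟩ := hB hb
    exact h.1.mono (hbv x trivial) (Set.union_subset_union (h.star_subset_pcompl b)
      (Set.singleton_subset_iff.2 hv))) x
  refine h.1.mono key (Set.union_subset_union_left _ (h.pcompl_anti fun u hu => ?_))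
  exact h.1.mono (hU u hu) fun b hb => ⟨b, hb, rfl⟩

end Covers

/-! ### Covers presented by geometric theories -/

section Presented

variable {P : Type*} {T : Finset P → Set (Finset P) → Prop}

theorem GCov_mono {A : Finset P} {𝒰 𝒱 : Set (Finset P)} (hA : GCov T A 𝒰) (h : 𝒰 ⊆ 𝒱) :
    GCov T A 𝒱 :=
  GCov_trans hA fun _ hB => GCov.refl (h hB)

theorem GCov_subset {A B : Finset P} (h : B ⊆ A) : GCov T A {B} :=
  GCov.le h (GCov.refl rfl)

theorem GCov_of_ax {A : Finset P} {𝒰 : Set (Finset P)} (h : T A 𝒰) : GCov T A 𝒰 := by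
  have := GCov.ax (T := T) (𝒰 := 𝒰) ∅ h fun B hB => by
    rw [Finset.empty_union]
    exact GCov.refl hB
  rwa [Finset.empty_union] at this

/-- Covers are stable under meets with a fixed basic open. -/
theorem GCov_union {A : Finset P} {𝒰 : Set (Finset P)} (C : Finset P) (h : GCov T A 𝒰) :
    GCov T (C ∪ A) {D | ∃ B ∈ 𝒰, D = C ∪ B} := by
  induction h with
  | refl hA => exact GCov.refl ⟨_, hA, rfl⟩
  | le hBA _ ih => exact GCov.le (Finset.union_subset_union_right hBA) ih
  | ax C' hT _ ih =>
    rw [← Finset.union_assoc]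
    refine GCov.ax (C ∪ C') hT fun B hB => ?_
    rw [Finset.union_assoc]
    exact ih B hB

theorem GCov_union_trans {A C : Finset P} {𝒰 𝒱 : Set (Finset P)} (h : GCov T A 𝒰)
    (h' : ∀ B ∈ 𝒰, GCov T (C ∪ B) 𝒱) : GCov T (C ∪ A) 𝒱 := by
  refine GCov_trans (GCov_union C h) ?_
  rintro _ ⟨B, hB, rfl⟩
  exact h' B hB

end Presented

section PatchCovers

variable {S : Type*} {cov : S → Set S → Prop} {le : S → S → Prop}

theorem patchCov_l_wbS (A : Finset S) :
    patchCov cov le {PatchGen.l A} {D | ∃ C : Finset S, wbS cov ↑A ↑C ∧ D = {PatchGen.l C}} := by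
  have := GCov_of_ax (PatchThy.L3 (cov := cov) (le := le) A A)
  rw [Finset.pair_eq_singleton] at this
  exact GCov_mono this fun D ⟨C, hC, _, hD⟩ => ⟨C, hC, hD⟩

theorem patchCov_l_union_r (h : IsBasicCover cov) {C : Finset S} {b : S} (hb : b ∈ C) :
    patchCov cov le ({PatchGen.r b} ∪ {PatchGen.l C}) ∅ := by
  refine GCov_union_trans (GCov_of_ax (PatchThy.L2 {b} C fun a ha => h.1 a _ ?_)) ?_
  · rw [Finset.coe_singleton] at ha
    rwa [Set.mem_singleton_iff.1 ha]
  · rintro _ rfl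
    exact GCov.le (by intro g; simp; tauto) (GCov_of_ax (PatchThy.D b))

theorem patchCov_empty_of_wb (h : IsBasicCover cov) {V : Set S} (E : Finset S)
    (hE : ∀ e ∈ E, ∃ b ∈ V, wb cov e b) :
    patchCov cov le ∅ ({{PatchGen.l E}} ∪ {D | ∃ b ∈ V, D = {PatchGen.r b}}) := by
  induction E using Finset.induction_on with
  | empty => exact GCov_mono (GCov_of_ax PatchThy.L1) Set.subset_union_left
  | insert e E _ ih =>
    obtain ⟨b, hb, heb⟩ := hE e (Finset.mem_insert_self e E)
    refine GCov_trans (ih fun e' he' => hE e' (Finset.mem_insert_of_mem he')) ?_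
    rintro _ (rfl | hD)
    · have hl : ∀ B ∈ ({{PatchGen.l {e}}, {PatchGen.r b}} : Set (Finset (PatchGen S))),
          GCov (PatchThy cov le) ({PatchGen.l E} ∪ B)
            ({{PatchGen.l (insert e E)}} ∪ {D | ∃ b ∈ V, D = {PatchGen.r b}}) := by
        rintro _ (rfl | rfl)
        · refine GCov_trans (GCov_of_ax (PatchThy.L3 E {e})) ?_
          rintro _ ⟨C, hEC, heC, rfl⟩
          refine GCov_mono (GCov_of_ax (PatchThy.L2 (insert e E) C ?_)) Set.subset_union_left
          intro a ha
          rcases Finset.mem_insert.1 (Finset.mem_coe.1 ha) with rfl | ha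
          · exact wbS_covS h heC a (by simp)
          · exact wbS_covS h hEC a ha
        · exact GCov.le Finset.subset_union_right (GCov.refl (Or.inr ⟨b, hb, rfl⟩))
      have := GCov_union_trans (GCov_of_ax (PatchThy.Loc (le := le) e b heb)) hl
      rwa [Finset.union_empty] at this
    · exact GCov.refl (Or.inr hD)

theorem patchCov_empty_of_wbS (h : IsBasicCover cov) {w : S → Set S} (hw : IsContinuous cov w)
    {A : Finset S} {V : Set S} (hAV : wbS cov ↑A V) :
    patchCov cov le ∅ ({{PatchGen.l A}} ∪ {D | ∃ b ∈ V, D = {PatchGen.r b}}) := by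
  obtain ⟨E, hAE, hE⟩ := hw.exists_finset_wb h hAV
  refine GCov_trans (patchCov_empty_of_wb h E hE) ?_
  rintro _ (rfl | hD)
  · exact GCov_mono (GCov_of_ax (PatchThy.L2 A E hAE)) Set.subset_union_left
  · exact GCov.refl (Or.inr hD)

end PatchCovers

/-! ### The lift of a perfect map to the patch -/

section Lift

variable {S S' : Type*} {cov : S → Set S → Prop} {le : S → S → Prop}
  {cov' : S' → Set S' → Prop} {le' : S' → S' → Prop} {r : S' → S → Prop}

/-- The opens of `S'` interpreting the generators of the patch. -/
def patchInterp (cov : S → Set S → Prop) (cov' : S' → Set S' → Prop) (le' : S' → S' → Prop)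
    (r : S' → S → Prop) : PatchGen S → Set S'
  | PatchGen.r a => rinv r {a}
  | PatchGen.l A => {x | ∃ B : Finset S, wbS cov ↑A ↑B ∧ x ∈ pcompl cov' le' (rinv r ↑B)}

/-- The lift of `r : S' → S` to `Patch(S)`. -/
def patchLift (cov : S → Set S → Prop) (cov' : S' → Set S' → Prop) (le' : S' → S' → Prop)
    (r : S' → S → Prop) (x : S') (𝔅 : Finset (PatchGen S)) : Prop :=
  ∀ g ∈ 𝔅, cov' x (patchInterp cov cov' le' r g)

theorem mem_rinv_singleton {α β : Type*} {f : α → β → Prop} {x : α} {b : β} :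
    x ∈ rinv f {b} ↔ f x b := by
  simp [rinv]

theorem IsBCM.cov_rinv {α β : Type*} {covα : α → Set α → Prop} {covβ : β → Set β → Prop}
    {f : α → β → Prop} (h : IsBasicCover covα) (hf : IsBCM covα covβ f) {x : α}
    {U V : Set β} (hx : covα x (rinv f U)) (hUV : covS covβ U V) : covα x (rinv f V) := by
  refine h.2 x _ _ hx ?_
  rintro y ⟨b, hb, hyb⟩
  exact hf b V (hUV b hb) y (mem_rinv_singleton.2 hyb)

theorem patchLift_of_le (h' : IsFormalTopology cov' le') {x y : S'} {𝔅 : Finset (PatchGen S)}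
    (hxy : le' x y) (hy : patchLift cov cov' le' r y 𝔅) : patchLift cov cov' le' r x 𝔅 :=
  fun g hg => h'.cov_of_le hxy (hy g hg)

theorem patchLift_of_cov (h' : IsBasicCover cov') {x : S'} {𝔅 : Finset (PatchGen S)}
    (hx : cov' x {y | patchLift cov cov' le' r y 𝔅}) : patchLift cov cov' le' r x 𝔅 :=
  fun g hg => h'.2 x _ _ hx fun _ hy => hy g hg

theorem patchLift_union {x : S'} {𝔄 𝔅 : Finset (PatchGen S)} :
    patchLift cov cov' le' r x (𝔄 ∪ 𝔅) ↔
      patchLift cov cov' le' r x 𝔄 ∧ patchLift cov cov' le' r x 𝔅 := by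
  simp only [patchLift, Finset.mem_union]
  exact ⟨fun h => ⟨fun g hg => h g (Or.inl hg), fun g hg => h g (Or.inr hg)⟩,
    fun h g hg => hg.elim (h.1 g) (h.2 g)⟩

theorem patchLift_singleton {x : S'} {g : PatchGen S} :
    patchLift cov cov' le' r x {g} ↔ cov' x (patchInterp cov cov' le' r g) := by
  simp [patchLift]

theorem patchLift_pair {x : S'} {g k : PatchGen S} :
    patchLift cov cov' le' r x {g, k} ↔
      cov' x (patchInterp cov cov' le' r g) ∧ cov' x (patchInterp cov cov' le' r k) := by
  simp [patchLift]

/-- A perfect map to a continuous cover turns `≪` into the well-inside relation over a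
regular topology. -/
theorem cov_pcompl_rinv_of_wbS (h : IsBasicCover cov) {w : S → Set S} (hw : IsContinuous cov w)
    (h' : IsFormalTopology cov' le') (hreg : Regular cov' le') (hr : IsBCM cov' cov r)
    (hp : IsPerfect cov' cov r) {U V : Set S} (hUV : wbS cov U V) (x : S') :
    cov' x (pcompl cov' le' (rinv r U) ∪ rinv r V) := by
  obtain ⟨D, hUD, hD⟩ := hw.exists_finset_wb h hUV
  have key := h'.cov_pcompl_iUnion D (F := fun d => rinv r {d}) (V := rinv r V)
    (fun d hd x => by
      obtain ⟨c, hc, hdc⟩ := hD d hd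
      refine h'.1.mono (hreg.cov_pcompl_of_wbS h' (hp d c hdc) x)
        (Set.union_subset_union_right _ ?_)
      rintro y ⟨_, rfl, hy⟩
      exact ⟨_, hc, hy⟩) x
  refine h'.1.mono key (Set.union_subset_union_left _ (h'.pcompl_anti ?_))
  rintro y ⟨u, hu, hy⟩
  refine h'.1.mono (hr u ↑D (hUD u hu) y (mem_rinv_singleton.2 hy)) ?_
  rintro z ⟨d, hd, hz⟩
  exact ⟨d, hd, mem_rinv_singleton.2 hz⟩

theorem IsFTM.cov_rinv_down {α β : Type*} {covα : α → Set α → Prop} {leα : α → α → Prop}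
    {covβ : β → Set β → Prop} {leβ : β → β → Prop} {f : α → β → Prop}
    (h : IsFormalTopology covα leα) (hf : IsFTM covα leα covβ leβ f) {x : α} {a b : β}
    (ha : covα x (rinv f {a})) (hb : covα x (rinv f {b})) :
    covα x (rinv f (down leβ {a} {b})) :=
  h.1.2 x _ _ (h.2.2.2.2 x _ _ ha hb) (hf.2.2 a b)

theorem patchLift_sound_ax (h : IsBasicCover cov) {w : S → Set S} (hw : IsContinuous cov w)
    (h' : IsFormalTopology cov' le') (hreg : Regular cov' le')
    (hr : IsFTM cov' le' cov le r) (hp : IsPerfect cov' cov r)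
    {𝔄 : Finset (PatchGen S)} {𝒞 : Set (Finset (PatchGen S))} (hT : PatchThy cov le 𝔄 𝒞)
    {x : S'} (hx : patchLift cov cov' le' r x 𝔄) :
    cov' x (rinv (patchLift cov cov' le' r) 𝒞) := by
  have hgen : ∀ {y : S'} {g : PatchGen S}, y ∈ patchInterp cov cov' le' r g →
      patchLift cov cov' le' r y {g} := fun hy => patchLift_singleton.2 (h'.1.1 _ _ hy)
  cases hT with
  | R1 =>
    refine h'.1.mono (hr.2.1 x trivial) ?_
    rintro y ⟨a, -, hy⟩
    exact ⟨_, ⟨a, rfl⟩, hgen (mem_rinv_singleton.2 hy)⟩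
  | R2 a b =>
    obtain ⟨ha, hb⟩ := patchLift_pair.1 hx
    refine h'.1.mono (hr.cov_rinv_down h' ha hb) ?_
    rintro y ⟨c, hc, hy⟩
    exact ⟨_, ⟨c, hc, rfl⟩, hgen (mem_rinv_singleton.2 hy)⟩
  | R3 a A haA =>
    refine h'.1.mono (hr.1.cov_rinv h'.1 (V := ↑A) (patchLift_singleton.1 hx) ?_) ?_
    · rintro _ rfl
      exact haA
    · rintro y ⟨c, hc, hy⟩
      exact ⟨_, ⟨c, hc, rfl⟩, hgen (mem_rinv_singleton.2 hy)⟩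
  | R4 a =>
    refine h'.1.mono (hr.1.cov_rinv h'.1 (V := {b | wb cov b a})
      (patchLift_singleton.1 hx) ?_) ?_
    · rintro _ rfl
      exact hw.cov_wb h _
    · rintro y ⟨c, hc, hy⟩
      exact ⟨_, ⟨c, hc, rfl⟩, hgen (mem_rinv_singleton.2 hy)⟩
  | L1 =>
    refine h'.1.1 _ _ ⟨_, rfl, hgen ⟨∅, ?_, ?_⟩⟩
    · exact wbS_of_forall_wb h (by simp)
    · intro y _ hy
      simpa [rinv] using hy
  | L2 A B hAB =>
    refine h'.1.1 _ _ ⟨_, rfl, patchLift_singleton.2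
      (h'.1.mono (patchLift_singleton.1 hx) ?_)⟩
    rintro y ⟨C, hBC, hy⟩
    exact ⟨C, covS_wbS h hAB hBC, hy⟩
  | L3 A B =>
    obtain ⟨hA, hB⟩ := patchLift_pair.1 hx
    refine h'.1.mono (h'.2.2.2.2 x _ _ hA hB) ?_
    rintro y ⟨u, ⟨A', hAA', hu⟩, v, ⟨B', hBB', hv⟩, hyu, hyv⟩
    obtain ⟨D, hAD, hDA'⟩ := hw.interpolate h hAA'
    obtain ⟨E, hBE, hEB'⟩ := hw.interpolate h hBB'
    refine ⟨_, ⟨D ∪ E, ?_, ?_, rfl⟩, hgen ⟨A' ∪ B', ?_, ?_⟩⟩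
    · exact wbS_covS_trans h hAD fun d hd => h.1 _ _ (by simp_all)
    · exact wbS_covS_trans h hBE fun d hd => h.1 _ _ (by simp_all)
    · refine wbS_of_forall_finset h (Finset.univ : Finset Bool)
        (fun i => if i then ↑D else ↑E) ?_ ?_
      · intro d hd
        exact h.1 _ _ (by simpa [or_comm] using hd)
      · rintro (_ | _) -
        · exact wbS_covS_trans h hEB' fun d hd => h.1 _ _ (by simp_all)
        · exact wbS_covS_trans h hDA' fun d hd => h.1 _ _ (by simp_all)
    · have := h'.pcompl_iUnion (I := (Set.univ : Set Bool)) (x := y)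
        (F := fun i => if i then rinv r ↑A' else rinv r ↑B') (by
          rintro (_ | _) -
          · exact h'.pcompl_of_le hyv hv
          · exact h'.pcompl_of_le hyu hu)
      refine h'.pcompl_anti ?_ this
      rintro z ⟨c, hc, hz⟩
      rcases Finset.mem_union.1 (Finset.mem_coe.1 hc) with hc | hc
      · exact h'.1.1 _ _ ⟨true, trivial, c, hc, hz⟩
      · exact h'.1.1 _ _ ⟨false, trivial, c, hc, hz⟩
  | Loc a b hab =>
    obtain ⟨D, haD, hDb⟩ := hw.interpolate h (wb_wbS hab (Set.mem_singleton b))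
    refine h'.1.mono (cov_pcompl_rinv_of_wbS h hw h' hreg hr.1 hp hDb x) ?_
    rintro y (hy | hy)
    · exact ⟨_, Or.inl rfl, hgen ⟨D, by rwa [Finset.coe_singleton], hy⟩⟩
    · exact ⟨_, Or.inr rfl, hgen hy⟩
  | D a =>
    obtain ⟨hl, ha⟩ := patchLift_pair.1 hx
    refine h'.cov_local hl ?_
    rintro y hyx u ⟨B, haB, hu⟩ hyu
    refine h'.1.mono (hu y hyu ?_) (Set.empty_subset _)
    refine hr.1.cov_rinv h'.1 (h'.cov_of_le hyx ha) ?_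
    rintro _ rfl
    exact wbS_covS h haB _ (by simp)

theorem patchLift_sound (h : IsBasicCover cov) {w : S → Set S} (hw : IsContinuous cov w)
    (h' : IsFormalTopology cov' le') (hreg : Regular cov' le')
    (hr : IsFTM cov' le' cov le r) (hp : IsPerfect cov' cov r)
    {𝔄 : Finset (PatchGen S)} {𝒰 : Set (Finset (PatchGen S))} (hA : patchCov cov le 𝔄 𝒰)
    {x : S'} (hx : patchLift cov cov' le' r x 𝔄) :
    cov' x (rinv (patchLift cov cov' le' r) 𝒰) := by
  unfold patchCov at hA
  induction hA generalizing x with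
  | refl hA => exact h'.1.1 _ _ ⟨_, hA, hx⟩
  | le hBA _ ih => exact ih fun g hg => hx g (hBA hg)
  | ax C hT _ ih =>
    obtain ⟨hC, hA⟩ := patchLift_union.1 hx
    refine h'.cov_local (patchLift_sound_ax h hw h' hreg hr hp hT hA) ?_
    rintro y hyx u ⟨B, hB, hu⟩ hyu
    exact ih B hB (patchLift_union.2 ⟨patchLift_of_le h' hyx hC, patchLift_of_le h' hyu hu⟩)

theorem patchLift_isFTM (h : IsBasicCover cov) {w : S → Set S} (hw : IsContinuous cov w)
    (h' : IsFormalTopology cov' le') (hreg : Regular cov' le')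
    (hr : IsFTM cov' le' cov le r) (hp : IsPerfect cov' cov r) :
    IsFTM cov' le' (patchCov cov le) supord (patchLift cov cov' le' r) := by
  refine ⟨fun 𝔄 𝒰 hA x hx =>
    patchLift_sound h hw h' hreg hr hp hA (mem_rinv_singleton.1 hx), fun x _ => ?_, ?_⟩
  · exact h'.1.1 _ _ ⟨∅, trivial, by simp [patchLift]⟩
  · rintro 𝔄 𝔅 x ⟨u, hu, v, hv, hxu, hxv⟩
    refine h'.1.1 _ _ ⟨𝔄 ∪ 𝔅, ⟨𝔄, rfl, 𝔅, rfl, Finset.subset_union_left,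
      Finset.subset_union_right⟩, patchLift_union.2 ⟨?_, ?_⟩⟩
    · exact patchLift_of_le h' hxu (mem_rinv_singleton.1 hu)
    · exact patchLift_of_le h' hxv (mem_rinv_singleton.1 hv)

/-- Every basic open of the patch is covered by basic opens whose inverse images are well
inside its inverse image. -/
theorem patchCov_wellInside (h : IsBasicCover cov) {w : S → Set S} (hw : IsContinuous cov w)
    (h' : IsFormalTopology cov' le') (hreg : Regular cov' le')
    (hr : IsFTM cov' le' cov le r) (hp : IsPerfect cov' cov r) (𝔅 : Finset (PatchGen S)) :
    patchCov cov le 𝔅 {𝔄 | ∀ x, cov' x (pcompl cov' le' {y | patchLift cov cov' le' r y 𝔄} ∪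
      {y | patchLift cov cov' le' r y 𝔅})} := by
  induction 𝔅 using Finset.induction_on with
  | empty =>
    exact GCov.refl fun x => h'.1.1 _ _ (Or.inr (by simp [patchLift]))
  | insert g 𝔅 _ ih =>
    have hg : patchCov cov le {g} {𝔄 | ∀ x, cov' x
        (pcompl cov' le' {y | patchLift cov cov' le' r y 𝔄} ∪
          {y | patchLift cov cov' le' r y {g}})} := by
      cases g with
      | r a =>
        refine GCov_mono (GCov_of_ax (PatchThy.R4 a)) ?_
        rintro _ ⟨b, hba, rfl⟩ x
        refine h'.1.mono (cov_pcompl_rinv_of_wbS h hw h' hreg hr.1 hp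
          (wb_wbS hba (Set.mem_singleton a)) x) (Set.union_subset_union ?_ ?_)
        · exact h'.pcompl_anti fun y hy => patchLift_singleton.1 hy
        · exact fun y hy => patchLift_singleton.2 (h'.1.1 _ _ hy)
      | l A =>
        refine GCov_mono (patchCov_l_wbS A) ?_
        rintro _ ⟨C, hAC, rfl⟩ x
        obtain ⟨D, hAD, hDC⟩ := hw.interpolate h hAC
        refine h'.1.mono (cov_pcompl_rinv_of_wbS h hw h' hreg hr.1 hp hDC x) ?_
        rintro y (hy | hy)
        · exact Or.inr (patchLift_singleton.2 (h'.1.1 _ _ ⟨D, hAD, hy⟩))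
        · refine Or.inl fun z hzy hz => ?_
          have hzl : cov' z (patchInterp cov cov' le' r (PatchGen.l C)) :=
            h'.1.2 z _ _ hz fun t ht => patchLift_singleton.1 ht
          refine h'.cov_local hzl ?_
          rintro t htz u ⟨B, hCB, hu⟩ htu
          exact hu t htu (hr.1.cov_rinv h'.1 (h'.cov_of_le (h'.2.2.1 htz hzy)
            (h'.1.1 _ _ hy)) (wbS_covS h hCB))
    rw [Finset.insert_eq, Finset.union_comm]
    refine GCov_union_trans hg fun 𝔄 hA => ?_
    rw [Finset.union_comm]
    refine GCov_union_trans ih fun 𝔄' hA' => GCov.refl fun x => ?_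
    refine h'.cov_local (hA x) ?_
    rintro y - u (hu | hu) hyu
    · refine h'.1.1 _ _ (Or.inl (h'.pcompl_anti ?_ (h'.pcompl_of_le hyu hu)))
      exact fun z hz => h'.1.1 _ _ (patchLift_union.1 hz).1
    · refine h'.cov_local (hA' y) ?_
      rintro z hzy v (hv | hv) hzv
      · refine h'.1.1 _ _ (Or.inl (h'.pcompl_anti ?_ (h'.pcompl_of_le hzv hv)))
        exact fun z hz => h'.1.1 _ _ (patchLift_union.1 hz).2
      · refine h'.1.1 _ _ (Or.inr (patchLift_union.2 ⟨?_, ?_⟩))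
        · exact patchLift_of_le h' hzv hv
        · exact patchLift_of_le h' (h'.2.2.1 hzy hyu) hu

theorem patchLift_isPerfect (h : IsBasicCover cov) {w : S → Set S} (hw : IsContinuous cov w)
    (h' : IsFormalTopology cov' le') (hreg : Regular cov' le')
    (hr : IsFTM cov' le' cov le r) (hp : IsPerfect cov' cov r) :
    IsPerfect cov' (patchCov cov le) (patchLift cov cov' le' r) := by
  intro 𝔄 𝔅 hAB
  have hbound : patchCov cov le ∅ {D | ∃ a b : S, wb cov a b ∧ D = {PatchGen.r a}} := by
    refine GCov_trans (GCov_of_ax PatchThy.R1) ?_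
    rintro _ ⟨b, rfl⟩
    exact GCov_mono (GCov_of_ax (PatchThy.R4 b)) fun D ⟨a, hab, hD⟩ => ⟨a, b, hab, hD⟩
  have hcover : patchCov cov le 𝔅 {D | (∃ a b : S, wb cov a b ∧ PatchGen.r a ∈ D) ∧
      ∀ x, cov' x (pcompl cov' le' {y | patchLift cov cov' le' r y D} ∪
        {y | patchLift cov cov' le' r y 𝔅})} := by
    refine GCov_trans (patchCov_wellInside h hw h' hreg hr hp 𝔅) fun D hD => ?_
    rw [← Finset.union_empty D]
    refine GCov_union_trans hbound ?_
    rintro _ ⟨a, b, hab, rfl⟩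
    refine GCov.refl ⟨⟨a, b, hab, by simp⟩, fun x => h'.1.mono (hD x)
      (Set.union_subset_union_left _ (h'.pcompl_anti fun y hy =>
        h'.1.1 _ _ (patchLift_union.1 hy).1))⟩
  obtain ⟨I, hI, hAI⟩ := hAB _ hcover
  refine wbS_of_forall_finset h'.1 I (fun D => {y | patchLift cov cov' le' r y D})
    (fun x hx => patchLift_sound h hw h' hreg hr hp hAI (mem_rinv_singleton.1 hx)) ?_
  intro D hDI W hW
  obtain ⟨⟨a, b, hab, haD⟩, hD⟩ := hI hDI
  obtain ⟨E, hE, haE⟩ := hp a b hab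
    (pcompl cov' le' {y | patchLift cov cov' le' r y D} ∪ W) fun x _ =>
      h'.1.2 x _ _ (hD x) (by
        rintro y (hy | hy)
        · exact h'.1.1 _ _ (Or.inl hy)
        · exact h'.1.mono (hW y (mem_rinv_singleton.2 hy)) Set.subset_union_right)
  refine ⟨E.filter (· ∈ W), fun e he => (Finset.mem_filter.1 (Finset.mem_coe.1 he)).2,
    fun x hx => ?_⟩
  refine h'.cov_local (h'.1.2 x _ _ (hx _ haD) haE) ?_
  intro y hyx e he hye
  by_cases heW : e ∈ W
  · exact h'.cov_of_le hye (h'.1.1 _ _ (by simpa using ⟨he, heW⟩))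
  · have hpc := (hE he).resolve_right heW
    exact h'.1.mono (hpc y hye (h'.1.1 _ _ (patchLift_of_le h' hyx hx))) (Set.empty_subset _)

theorem epsP_comp_patchLift (h : IsBasicCover cov) {w : S → Set S} (hw : IsContinuous cov w)
    (h' : IsFormalTopology cov' le') (hreg : Regular cov' le')
    (hr : IsFTM cov' le' cov le r) (hp : IsPerfect cov' cov r) :
    MapEq cov' (comp (epsP cov le) (patchLift cov cov' le' r)) r := by
  refine ⟨fun a x hx => ?_, fun a x hx => ?_⟩
  · obtain ⟨𝔄, hx𝔄, h𝔄⟩ := mem_rinv_singleton.1 hx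
    refine h'.1.2 x _ _ (patchLift_sound h hw h' hreg hr hp h𝔄 hx𝔄) ?_
    intro y hy
    exact patchLift_singleton.1 (mem_rinv_singleton.1 hy)
  · exact h'.1.1 _ _ (mem_rinv_singleton.2
      ⟨{PatchGen.r a}, patchLift_singleton.2 (h'.1.1 _ _ hx), GCov.refl rfl⟩)

end Lift

/-! ### Uniqueness of the lift -/

section Uniqueness

variable {S S' : Type*} {cov : S → Set S → Prop} {le : S → S → Prop}
  {cov' : S' → Set S' → Prop} {le' : S' → S' → Prop} {r : S' → S → Prop}
  {f : S' → Finset (PatchGen S) → Prop}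

theorem cov_rinv_union_iff (h' : IsFormalTopology cov' le')
    (hf : IsFTM cov' le' (patchCov cov le) supord f) {x : S'} {𝔄 𝔅 : Finset (PatchGen S)} :
    cov' x (rinv f {𝔄 ∪ 𝔅}) ↔ cov' x (rinv f {𝔄}) ∧ cov' x (rinv f {𝔅}) := by
  refine ⟨fun hx => ⟨?_, ?_⟩, fun ⟨hA, hB⟩ => ?_⟩
  · refine hf.1.cov_rinv h'.1 hx ?_
    rintro _ rfl
    exact GCov_subset Finset.subset_union_left
  · refine hf.1.cov_rinv h'.1 hx ?_
    rintro _ rfl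
    exact GCov_subset Finset.subset_union_right
  · refine hf.1.cov_rinv h'.1 (hf.cov_rinv_down h' hA hB) ?_
    rintro D ⟨_, rfl, _, rfl, hA, hB⟩
    exact GCov_subset (Finset.union_subset hA hB)

theorem cov_rinv_of_patchCov_empty (h' : IsFormalTopology cov' le')
    (hf : IsFTM cov' le' (patchCov cov le) supord f) {𝒰 : Set (Finset (PatchGen S))}
    (h𝒰 : patchCov cov le ∅ 𝒰) (x : S') : cov' x (rinv f 𝒰) :=
  hf.1.cov_rinv h'.1 (hf.2.1 x trivial) fun _ _ => GCov.le (Finset.empty_subset _) h𝒰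

theorem cov_rinv_r_iff (h' : IsFormalTopology cov' le')
    (hf : IsFTM cov' le' (patchCov cov le) supord f)
    (hfr : MapEq cov' (comp (epsP cov le) f) r) {x : S'} {a : S} :
    cov' x (rinv f {{PatchGen.r a}}) ↔ cov' x (rinv r {a}) := by
  refine ⟨fun hx => h'.1.2 x _ _ hx fun y hy => hfr.1 a y ?_,
    fun hx => h'.1.2 x _ _ hx fun y hy => h'.1.2 y _ _ (hfr.2 a y hy) ?_⟩
  · exact mem_rinv_singleton.2 ⟨_, mem_rinv_singleton.1 hy, GCov.refl rfl⟩
  · intro z hz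
    obtain ⟨𝔄, hz𝔄, h𝔄⟩ := mem_rinv_singleton.1 hz
    exact hf.1 𝔄 _ h𝔄 z (mem_rinv_singleton.2 hz𝔄)

theorem cov_rinv_gen_iff (h : IsBasicCover cov) {w : S → Set S} (hw : IsContinuous cov w)
    (h' : IsFormalTopology cov' le')
    (hf : IsFTM cov' le' (patchCov cov le) supord f)
    (hfr : MapEq cov' (comp (epsP cov le) f) r) {x : S'} (g : PatchGen S) :
    cov' x (rinv f {{g}}) ↔ cov' x (patchInterp cov cov' le' r g) := by
  cases g with
  | r a => exact cov_rinv_r_iff h' hf hfr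
  | l A =>
    constructor
    · intro hx
      have hx' := hf.1.cov_rinv h'.1 hx (V := {D | ∃ C : Finset S,
        wbS cov ↑A ↑C ∧ D = {PatchGen.l C}}) (by
          rintro _ rfl
          exact patchCov_l_wbS A)
      refine h'.1.mono hx' ?_
      rintro y ⟨_, ⟨C, hAC, rfl⟩, hy⟩
      refine ⟨C, hAC, fun z hzy hz => h'.cov_local hz ?_⟩
      rintro t htz u ⟨c, hc, hu⟩ htu
      have ht : cov' t (rinv f {{PatchGen.r c} ∪ {PatchGen.l C}}) :=
        (cov_rinv_union_iff h' hf).2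
          ⟨(cov_rinv_r_iff h' hf hfr).2
            (h'.cov_of_le htu (h'.1.1 _ _ (mem_rinv_singleton.2 hu))),
          h'.cov_of_le (h'.2.2.1 htz hzy) (h'.1.1 _ _ (mem_rinv_singleton.2 hy))⟩
      refine h'.1.mono (hf.1.cov_rinv h'.1 ht (V := ∅) ?_) ?_
      · rintro _ rfl
        exact patchCov_l_union_r h hc
      · rintro s ⟨_, hs, _⟩
        exact hs
    · refine fun hx => h'.1.2 x _ _ hx ?_
      rintro y ⟨B, hAB, hy⟩
      refine h'.cov_local
        (cov_rinv_of_patchCov_empty h' hf (patchCov_empty_of_wbS h hw hAB) y) ?_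
      rintro z hzy u ⟨_, rfl | ⟨b, hb, rfl⟩, hu⟩ hzu
      · exact h'.cov_of_le hzu (h'.1.1 _ _ (mem_rinv_singleton.2 hu))
      · refine h'.1.mono (hy z hzy ?_) (Set.empty_subset _)
        have hzb : cov' z (rinv r {b}) := (cov_rinv_r_iff h' hf hfr).1
          (h'.cov_of_le hzu (h'.1.1 _ _ (mem_rinv_singleton.2 hu)))
        refine h'.1.mono hzb ?_
        rintro t ⟨_, rfl, ht⟩
        exact ⟨_, hb, ht⟩

theorem cov_rinv_iff_patchLift (h : IsBasicCover cov) {w : S → Set S}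
    (hw : IsContinuous cov w) (h' : IsFormalTopology cov' le')
    (hf : IsFTM cov' le' (patchCov cov le) supord f)
    (hfr : MapEq cov' (comp (epsP cov le) f) r) {x : S'} (𝔅 : Finset (PatchGen S)) :
    cov' x (rinv f {𝔅}) ↔ patchLift cov cov' le' r x 𝔅 := by
  induction 𝔅 using Finset.induction_on with
  | empty =>
    exact iff_of_true (cov_rinv_of_patchCov_empty h' hf (GCov_subset subset_rfl) x)
      (by simp [patchLift])
  | insert g 𝔅 _ ih =>
    rw [Finset.insert_eq, cov_rinv_union_iff h' hf, patchLift_union, ih, patchLift_singleton,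
      cov_rinv_gen_iff h hw h' hf hfr]

end Uniqueness

/-- Universal property of the patch: for every locally compact
regular formal topology `S'` and every perfect map `r : S' → S` into a stably
locally compact formal topology `S`, there is a unique perfect map
`r̃ : S' → Patch(S)` with `ε_P ∘ r̃ = r` (so the patch construction exhibits
locally compact regular formal topologies as a coreflective subcategory of
stably locally compact formal topologies and perfect maps). -/
theorem patch_universal_property {S : Type u}
    (cov : S → Set S → Prop) (le : S → S → Prop)
    (hft : IsFormalTopology cov le) (w : S → Set S) (hw : IsContinuous cov w)
    (hst : Stable cov le) :
    ∀ (S' : Type u) (cov' : S' → Set S' → Prop) (le' : S' → S' → Prop),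
      IsFormalTopology cov' le' → (∃ w', IsContinuous cov' w') → Regular cov' le' →
      ∀ r : S' → S → Prop, IsFTM cov' le' cov le r → IsPerfect cov' cov r →
        ∃ rt : S' → Finset (PatchGen S) → Prop,
          (IsFTM cov' le' (patchCov cov le) supord rt ∧
           IsPerfect cov' (patchCov cov le) rt ∧
           MapEq cov' (comp (epsP cov le) rt) r) ∧
          ∀ rt' : S' → Finset (PatchGen S) → Prop,
            (IsFTM cov' le' (patchCov cov le) supord rt' ∧
             IsPerfect cov' (patchCov cov le) rt' ∧
             MapEq cov' (comp (epsP cov le) rt') r) →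
            MapEq cov' rt' rt := by
  intro S' cov' le' h' _ hreg r hr hp
  refine ⟨patchLift cov cov' le' r, ⟨patchLift_isFTM hft.1 hw h' hreg hr hp,
    patchLift_isPerfect hft.1 hw h' hreg hr hp,
    epsP_comp_patchLift hft.1 hw h' hreg hr hp⟩, ?_⟩
  rintro f ⟨hf, -, hfr⟩
  refine ⟨fun 𝔅 x hx => h'.1.1 _ _ (mem_rinv_singleton.2 ?_), fun 𝔅 x hx => ?_⟩
  · exact (cov_rinv_iff_patchLift hft.1 hw h' hf hfr 𝔅).1 (h'.1.1 _ _ hx)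
  · exact (cov_rinv_iff_patchLift hft.1 hw h' hf hfr 𝔅).2 (mem_rinv_singleton.1 hx)

end FTP
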